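/- Let f_1, ..., f_r be a regular sequence in S = K[x_1,...,x_n] with a fixed monomial order. Then the leading monomials in(f_1), ..., in(f_r) form a regular sequence in S if and only if {f_1, ..., f_r} is a Gröbner basis of the ideal (f_1, ..., f_r). -/

import Mathlib

open MvPolynomial

variable {K : Type*} [Field K] {n : ℕ}

/-- The leading monomial (exponent vector) of a polynomial with respect to a monomial
order `m`: the maximum of the support; by convention `lm m 0 = 0`. -/
noncomputable def lm (m : MonomialOrder (Fin n)) (f : MvPolynomial (Fin n) K) :
    Fin n →₀ ℕ :=
  m.toSyn.symm (f.support.sup fun d => m.toSyn d)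

/-- The initial ideal of `I`: the ideal generated by the leading monomials of the
nonzero elements of `I`. -/
noncomputable def initialIdeal (m : MonomialOrder (Fin n))
    (I : Ideal (MvPolynomial (Fin n) K)) : Ideal (MvPolynomial (Fin n) K) :=
  Ideal.span {p | ∃ f ∈ I, f ≠ 0 ∧ p = monomial (lm m f) (1 : K)}

/-- `G` is a Gröbner basis of `I`: a finite set of nonzero polynomials generating `I`
whose leading monomials generate the initial ideal of `I`. -/
def IsGroebnerBasis (m : MonomialOrder (Fin n)) (I : Ideal (MvPolynomial (Fin n) K))
    (G : Set (MvPolynomial (Fin n) K)) : Prop :=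
  G.Finite ∧ (0 : MvPolynomial (Fin n) K) ∉ G ∧ Ideal.span G = I ∧
    Ideal.span ((fun g => monomial (lm m g) (1 : K)) '' G) = initialIdeal m I

/-- The S-polynomial `S(f,g)` with respect to the monomial order `m`. -/
noncomputable def sPoly (m : MonomialOrder (Fin n)) (f g : MvPolynomial (Fin n) K) :
    MvPolynomial (Fin n) K :=
  monomial (lm m f ⊔ lm m g - lm m f) (f.coeff (lm m f))⁻¹ * f -
    monomial (lm m f ⊔ lm m g - lm m g) (g.coeff (lm m g))⁻¹ * g

/-- An ideal is a monomial ideal if it is generated by monomials. -/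
def IsMonomialIdeal (I : Ideal (MvPolynomial (Fin n) K)) : Prop :=
  ∃ M : Set (Fin n →₀ ℕ), I = Ideal.span ((fun μ => (monomial μ (1 : K))) '' M)

section RegularSequence

open RingTheory.Sequence

/-- The length of an `M`-regular sequence is at most the dimension of the support of `M`. -/
lemma RingTheory.Sequence.IsRegular.length_le_supportDim {R M : Type*} [CommRing R]
    [AddCommGroup M] [Module R M] [Module.Finite R M] {rs : List R} (h : IsRegular M rs) :
    (rs.length : WithBot ℕ∞) ≤ Module.supportDim R M := by
  induction rs generalizing M with
  | nil =>
    have := h.nontrivial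
    have : Nonempty (Module.support R M) := Module.nonempty_support_of_nontrivial.to_subtype
    simpa [Module.supportDim] using Order.krullDim_nonneg
  | cons r rs ih =>
    obtain ⟨hr, hrs⟩ := (isRegular_cons_iff M r rs).mp h
    refine le_trans ?_ (Module.supportDim_quotSMulTop_succ_le_of_notMem_minimalPrimes
      fun _ ↦ hr.notMem_of_mem_minimalPrimes)
    push_cast [List.length_cons]
    gcongr
    exact ih hrs

lemma RingTheory.Sequence.IsRegular.length_le_ringKrullDim {R : Type*} [CommRing R]
    {rs : List R} (h : IsRegular R rs) : (rs.length : WithBot ℕ∞) ≤ ringKrullDim R :=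
  Module.supportDim_self_eq_ringKrullDim R ▸ h.length_le_supportDim

lemma RingTheory.Sequence.IsRegular.ofList_ne_top {R : Type*} [CommRing R]
    {rs : List R} (h : IsRegular R rs) : Ideal.ofList rs ≠ ⊤ := by
  simpa using h.top_ne_smul.symm

lemma RingTheory.Sequence.IsWeaklyRegular.isRegular_of_ofList_ne_top {R : Type*} [CommRing R]
    {rs : List R} (h : IsWeaklyRegular R rs) (hne : Ideal.ofList rs ≠ ⊤) : IsRegular R rs :=
  ⟨h, by rw [smul_eq_mul, Ideal.mul_top]; exact hne.symm⟩

/-- The length of a weakly regular sequence is at most the dimension of any localization in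
which the ideal it generates remains proper. -/
lemma RingTheory.Sequence.IsWeaklyRegular.length_le_ringKrullDim_of_isLocalization
    {R : Type*} [CommRing R] {rs : List R} (h : IsWeaklyRegular R rs) (S : Type*) [CommRing S]
    [Algebra R S] (N : Submonoid R) [IsLocalization N S]
    (hdisj : Disjoint (N : Set R) (Ideal.ofList rs : Set R)) :
    (rs.length : WithBot ℕ∞) ≤ ringKrullDim S := by
  have hne : Ideal.ofList (rs.map (algebraMap R S)) ≠ ⊤ := by
    rw [← Ideal.map_ofList]
    exact (IsLocalization.map_algebraMap_ne_top_iff_disjoint N S _).mpr hdisj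
  simpa using ((h.of_isLocalization S N).isRegular_of_ofList_ne_top hne).length_le_ringKrullDim

lemma RingTheory.Sequence.IsRegular.zero_notMem {R : Type*} [CommRing R]
    {rs : List R} (h : IsRegular R rs) : (0 : R) ∉ rs := by
  intro h0
  obtain ⟨i, hi, hi0⟩ := List.getElem_of_mem h0
  have h1 := (isSMulRegular_quotient_iff_mem_of_smul_mem _ _).mp
    (h.regular_mod_prev i hi) 1 (by simp [hi0])
  simp only [smul_eq_mul, Ideal.mul_top] at h1
  exact h.ofList_ne_top ((Ideal.eq_top_iff_one _).mpr
    (Ideal.span_mono (fun _ hx ↦ List.mem_of_mem_take hx) h1))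

lemma Ideal.ofList_ofFn {R : Type*} [CommRing R] {r : ℕ} (f : Fin r → R) :
    Ideal.ofList (List.ofFn f) = Ideal.span (Set.range f) := by
  refine congrArg Ideal.span (Set.ext fun x ↦ ?_)
  simp [List.mem_ofFn]

end RegularSequence

attribute [local instance] MvPolynomial.algebraMvPolynomial

lemma MvPolynomial.ringKrullDim_coe_finset {σ F : Type*} [Field F] (A : Finset σ) :
    ringKrullDim (MvPolynomial {a // a ∈ A} F) = A.card := by
  simp [MvPolynomial.ringKrullDim_of_isNoetherianRing]

/-- If every nonzero element of the ideal generated by a regular sequence involves a variable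
from `A`, then the length of the sequence is at most the cardinality of `A`. -/
lemma MvPolynomial.length_le_card_of_isRegular {σ : Type*} [Finite σ] (A : Finset σ)
    {rs : List (MvPolynomial σ K)}
    (hreg : RingTheory.Sequence.IsRegular (MvPolynomial σ K) rs)
    (hA : ∀ h ∈ Ideal.ofList rs, h ≠ 0 → ∃ d ∈ h.support, ∃ a ∈ A, d a ≠ 0) :
    rs.length ≤ A.card := by
  classical
  let B := {a // a ∉ A}
  let P := MvPolynomial B K
  let T := MvPolynomial {a // a ∈ A} P
  let L := MvPolynomial {a // a ∈ A} (FractionRing P)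
  let e : MvPolynomial σ K ≃+* T :=
    (renameEquiv K (Equiv.sumCompl (· ∈ A)).symm).toRingEquiv.trans (sumRingEquiv K _ _)
  have he (q : P) : e (rename Subtype.val q) = C q := by
    induction q using MvPolynomial.induction_on with
    | C a =>
      rw [rename_C]
      exact (congrArg (sumRingEquiv K _ _) (rename_C _ a)).trans (sumRingEquiv_C K _ _ a)
    | add p q hp hq => simp only [map_add, hp, hq]
    | mul_X p b hp =>
      simp only [map_mul, hp, rename_X]
      congr 1
      refine (congrArg (sumRingEquiv K _ _) ((rename_X _ _).trans ?_)).trans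
        (sumRingEquiv_X_inr K _ _ b)
      rw [Equiv.sumCompl_symm_apply_of_neg b.2]
  have hT : RingTheory.Sequence.IsWeaklyRegular T (rs.map e) :=
    (AddEquiv.isWeaklyRegular_congr (e := e.toAddEquiv) (by
      rw [List.forall₂_map_right_iff, List.forall₂_same]
      intro r _ x
      simp)).mp hreg.toIsWeaklyRegular
  let N : Submonoid T := (nonZeroDivisors P).map C
  have hdisj : Disjoint (N : Set T) (Ideal.ofList (rs.map e) : Set T) := by
    rw [Set.disjoint_left]
    rintro _ ⟨q, hq, rfl⟩ hmem
    have hq0 : q ≠ 0 := nonZeroDivisors.ne_zero hq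
    have hI : rename Subtype.val q ∈ Ideal.ofList rs := by
      have hmap : Ideal.ofList (rs.map e) = (Ideal.ofList rs).map e :=
        (Ideal.map_ofList e.toRingHom rs).symm
      rw [SetLike.mem_coe, hmap] at hmem
      obtain ⟨y, hy, hye⟩ := (Ideal.mem_map_of_equiv e _).mp hmem
      rw [show rename Subtype.val q = y from e.injective ((he q).trans hye.symm)]
      exact hy
    obtain ⟨d, hd, a, ha, hda⟩ := hA _ hI
      ((map_ne_zero_iff _ (rename_injective _ Subtype.val_injective)).mpr hq0)
    rw [support_rename_of_injective Subtype.val_injective, Finset.mem_image] at hd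
    obtain ⟨d', -, rfl⟩ := hd
    refine hda (Finsupp.mapDomain_of_notMem_range _ _ ?_)
    rintro ⟨b, rfl⟩
    exact b.2 ha
  have hdim := hT.length_le_ringKrullDim_of_isLocalization L N hdisj
  rw [MvPolynomial.ringKrullDim_coe_finset, List.length_map] at hdim
  exact_mod_cast hdim

/-- If a regular sequence of length `r` generates an ideal all of whose nonzero elements have a
term divisible by one of `r` nontrivial monomials, these monomials are pairwise coprime. -/
lemma MvPolynomial.pairwise_disjoint_of_isRegular {σ : Type*} [Finite σ] {r : ℕ}
    {f : Fin r → MvPolynomial σ K} {u : Fin r → σ →₀ ℕ}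
    (hreg : RingTheory.Sequence.IsRegular (MvPolynomial σ K) (List.ofFn f))
    (hu : ∀ i, u i ≠ 0)
    (hf : ∀ h ∈ Ideal.span (Set.range f), h ≠ 0 → ∃ d ∈ h.support, ∃ i, u i ≤ d) :
    Pairwise fun i j ↦ Disjoint (u i).support (u j).support := by
  classical
  intro i j hij
  by_contra hdis
  obtain ⟨x, hxi, hxj⟩ := Finset.not_disjoint_iff.mp hdis
  choose w hw using fun k ↦ Finsupp.ne_iff.mp (hu k)
  let v : Fin r → σ := fun k ↦ if k = i ∨ k = j then x else w k
  have hv (k) : u k (v k) ≠ 0 := by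
    by_cases hki : k = i
    · subst hki; simpa [v] using hxi
    by_cases hkj : k = j
    · subst hkj; simpa [v] using hxj
    simpa [v, hki, hkj] using hw k
  have hle := length_le_card_of_isRegular (Finset.univ.image v) hreg (by
    rw [Ideal.ofList_ofFn]
    intro h hh h0
    obtain ⟨d, hd, k, hk⟩ := hf h hh h0
    exact ⟨d, hd, v k, by simp, fun h ↦ hv k (Nat.le_zero.mp (h ▸ hk (v k)))⟩)
  have hcard : (Finset.univ.image v).card = (Finset.univ : Finset (Fin r)).card :=
    le_antisymm Finset.card_image_le (by simpa using hle)
  exact hij (Finset.card_image_iff.mp hcard (by simp) (by simp) (by simp [v]))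

lemma Finsupp.le_of_le_add_of_disjoint {σ : Type*} {u v d : σ →₀ ℕ} (h : u ≤ v + d)
    (huv : Disjoint u.support v.support) : u ≤ d := by
  intro a
  by_cases ha : a ∈ u.support
  · have hva : v a = 0 := Finsupp.notMem_support_iff.mp (Finset.disjoint_left.mp huv ha)
    simpa [hva] using h a
  · simp [Finsupp.notMem_support_iff.mp ha]

/-- Nontrivial pairwise coprime monomials form a regular sequence. -/
lemma MvPolynomial.isRegular_monomial {σ : Type*} {r : ℕ} {u : Fin r → σ →₀ ℕ}
    (hu : ∀ i, u i ≠ 0) (hdis : Pairwise fun i j ↦ Disjoint (u i).support (u j).support) :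
    RingTheory.Sequence.IsRegular (MvPolynomial σ K)
      (List.ofFn fun i ↦ (monomial (u i) 1 : MvPolynomial σ K)) := by
  refine RingTheory.Sequence.IsWeaklyRegular.isRegular_of_ofList_ne_top ⟨fun i hi ↦ ?_⟩ ?_
  · have hir : i < r := by simpa using hi
    have hspan : Ideal.ofList
        ((List.ofFn fun i ↦ (monomial (u i) 1 : MvPolynomial σ K)).take i) =
        Ideal.span ((fun s ↦ monomial s (1 : K)) '' (u '' {k | k.1 < i})) := by
      refine congrArg Ideal.span (Set.ext fun p ↦ ?_)
      simp only [Set.mem_ofPred_eq, List.mem_take_iff_getElem, List.length_ofFn,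
        List.getElem_ofFn, Set.image_image, Set.mem_image]
      constructor
      · rintro ⟨k, hk, rfl⟩
        exact ⟨⟨k, by omega⟩, by simp; omega, rfl⟩
      · rintro ⟨k, hk, rfl⟩
        exact ⟨k, by omega, rfl⟩
    rw [isSMulRegular_quotient_iff_mem_of_smul_mem]
    simp only [smul_eq_mul, Ideal.mul_top, List.getElem_ofFn, hspan]
    intro x hx
    rw [mem_ideal_span_monomial_image] at hx ⊢
    intro d hd
    obtain ⟨_, ⟨k, hk, rfl⟩, hle⟩ := hx (u ⟨i, hir⟩ + d) (by
      rw [mem_support_iff, coeff_monomial_mul, one_mul]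
      exact mem_support_iff.mp hd)
    refine ⟨u k, ⟨k, hk, rfl⟩, Finsupp.le_of_le_add_of_disjoint hle (hdis ?_)⟩
    rintro rfl
    simp at hk
  · rw [Ideal.ofList_ofFn, Ideal.ne_top_iff_one]
    rw [show Set.range (fun i ↦ (monomial (u i) 1 : MvPolynomial σ K)) =
      (fun s ↦ monomial s (1 : K)) '' Set.range u from Set.range_comp (fun s ↦ monomial s (1 : K)) u,
      mem_ideal_span_monomial_image]
    intro h
    obtain ⟨_, ⟨i, rfl⟩, hi⟩ := h 0 (by simp)
    exact hu i (nonpos_iff_eq_zero.mp hi)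

/-- If the leading monomials of nonzero polynomials are pairwise coprime, every nonzero
element of the ideal they generate has leading monomial divisible by one of them. -/
lemma MonomialOrder.exists_degree_le_of_mem_span {σ ι : Type*} (m : MonomialOrder σ)
    {f : ι → MvPolynomial σ K} (s : Finset ι) (h0 : ∀ i ∈ s, f i ≠ 0)
    (hdis : (s : Set ι).Pairwise fun i j ↦
      Disjoint (m.degree (f i)).support (m.degree (f j)).support)
    {h : MvPolynomial σ K} (hh : h ∈ Ideal.span (f '' s)) (hne : h ≠ 0) :
    ∃ i ∈ s, m.degree (f i) ≤ m.degree h := by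
  classical
  induction s using Finset.induction_on generalizing h with
  | empty => simp_all
  | insert j s hj ih =>
    have ih' {p : MvPolynomial σ K} (hp : p ∈ Ideal.span (f '' s)) (hp0 : p ≠ 0) :
        ∃ i ∈ s, m.degree (f i) ≤ m.degree p :=
      ih (fun i hi ↦ h0 i (Finset.mem_insert_of_mem hi)) (hdis.mono (by simp)) hp hp0
    rw [Finset.coe_insert, Set.image_insert_eq, Ideal.mem_span_insert] at hh
    obtain ⟨a, z, hz, rfl⟩ := hh
    have hunit (i : s) : IsUnit (m.leadingCoeff (f i)) :=
      (m.leadingCoeff_ne_zero_iff.mpr (h0 i (Finset.mem_insert_of_mem i.2))).isUnit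
    obtain ⟨g, t, ha, -, ht⟩ := m.div hunit a
    set q := Finsupp.linearCombination (MvPolynomial σ K) (fun i : s ↦ f i) g with hq
    have hqmem : q ∈ Ideal.span (f '' s) := by
      rw [hq, Finsupp.linearCombination_apply]
      exact Ideal.sum_mem _ fun i _ ↦
        Ideal.mul_mem_left _ _ (Ideal.subset_span ⟨i, i.2, rfl⟩)
    have hpmem : q * f j + z ∈ Ideal.span (f '' s) :=
      Ideal.add_mem _ (Ideal.mul_mem_right _ _ hqmem) hz
    have hsum : a * f j + z = t * f j + (q * f j + z) := by rw [ha]; ring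
    rw [hsum] at hne ⊢
    set p := q * f j + z
    have hfj : f j ≠ 0 := h0 j (Finset.mem_insert_self _ _)
    by_cases ht0 : t = 0
    · rw [ht0, zero_mul, zero_add] at hne ⊢
      obtain ⟨i, hi, hle⟩ := ih' hpmem hne
      exact ⟨i, Finset.mem_insert_of_mem hi, hle⟩
    have hdeg : m.degree (t * f j) = m.degree t + m.degree (f j) := m.degree_mul ht0 hfj
    by_cases hp0 : p = 0
    · exact ⟨j, Finset.mem_insert_self _ _, by rw [hp0, add_zero, hdeg]; exact le_add_self⟩
    obtain ⟨i, hi, hle⟩ := ih' hpmem hp0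
    have hij : i ≠ j := fun h ↦ hj (h ▸ hi)
    have hned : m.degree (t * f j) ≠ m.degree p := by
      intro heq
      rw [← heq, hdeg, add_comm] at hle
      exact ht _ (m.degree_mem_support ht0) ⟨i, hi⟩
        (Finsupp.le_of_le_add_of_disjoint hle (hdis (by simp [hi]) (by simp) hij))
    have hmax := m.degree_add_of_ne hned
    rcases le_total (m.toSyn (m.degree (t * f j))) (m.toSyn (m.degree p)) with hc | hc
    · rw [sup_eq_right.mpr hc, EmbeddingLike.apply_eq_iff_eq] at hmax
      exact ⟨i, Finset.mem_insert_of_mem hi, hmax ▸ hle⟩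
    · rw [sup_eq_left.mpr hc, EmbeddingLike.apply_eq_iff_eq] at hmax
      exact ⟨j, Finset.mem_insert_self _ _, by rw [hmax, hdeg]; exact le_add_self⟩

/-- A finite set of nonzero polynomials is a Gröbner basis of the ideal it generates iff every
nonzero element of that ideal has leading monomial divisible by one of theirs. -/
lemma isGroebnerBasis_span_range_iff (m : MonomialOrder (Fin n)) {ι : Type*} [Finite ι]
    {f : ι → MvPolynomial (Fin n) K} (h0 : ∀ i, f i ≠ 0) :
    IsGroebnerBasis m (Ideal.span (Set.range f)) (Set.range f) ↔
      ∀ h ∈ Ideal.span (Set.range f), h ≠ 0 → ∃ i, m.degree (f i) ≤ m.degree h := by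
  have himage : (fun g ↦ monomial (lm m g) (1 : K)) '' Set.range f =
      (fun s ↦ monomial s (1 : K)) '' Set.range fun i ↦ m.degree (f i) := by
    rw [← Set.range_comp, ← Set.range_comp]
    rfl
  have hle : Ideal.span ((fun g ↦ monomial (lm m g) (1 : K)) '' Set.range f) ≤
      initialIdeal m (Ideal.span (Set.range f)) := by
    refine Ideal.span_mono ?_
    rintro _ ⟨_, ⟨i, rfl⟩, rfl⟩
    exact ⟨f i, Ideal.subset_span ⟨i, rfl⟩, h0 i, rfl⟩
  constructor
  · rintro ⟨-, -, -, heq⟩ h hh hne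
    have hmem : monomial (m.degree h) (1 : K) ∈ initialIdeal m (Ideal.span (Set.range f)) :=
      Ideal.subset_span ⟨h, hh, hne, rfl⟩
    rw [← heq, himage, mem_ideal_span_monomial_image] at hmem
    obtain ⟨_, ⟨i, rfl⟩, hi⟩ := hmem (m.degree h) (by simp)
    exact ⟨i, hi⟩
  · intro H
    refine ⟨Set.finite_range f, fun ⟨i, hi⟩ ↦ h0 i hi, rfl, le_antisymm hle ?_⟩
    rw [himage, initialIdeal, Ideal.span_le]
    rintro _ ⟨h, hh, hne, rfl⟩
    obtain ⟨i, hi⟩ := H h hh hne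
    rw [SetLike.mem_coe, mem_ideal_span_monomial_image]
    intro d hd
    obtain rfl : d = m.degree h := by simpa using! support_monomial_subset hd
    exact ⟨_, ⟨i, rfl⟩, hi⟩

/-- For a regular sequence `f₁, …, f_r` in `S`: the leading monomials form a regular
sequence in `S` iff `{f₁, …, f_r}` is a Gröbner basis of the ideal they generate. -/
theorem stmt9 (m : MonomialOrder (Fin n)) (r : ℕ) (f : Fin r → MvPolynomial (Fin n) K)
    (hreg : RingTheory.Sequence.IsRegular (MvPolynomial (Fin n) K) (List.ofFn f)) :
    RingTheory.Sequence.IsRegular (MvPolynomial (Fin n) K)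
        ((List.ofFn f).map fun p => (monomial (lm m p) (1 : K) : MvPolynomial (Fin n) K)) ↔
      IsGroebnerBasis m (Ideal.span (Set.range f)) (Set.range f) := by
  have h0 (i) : f i ≠ 0 := fun hi ↦ hreg.zero_notMem ((List.mem_ofFn' f 0).mpr ⟨i, hi⟩)
  have hmap : ((List.ofFn f).map fun p ↦ (monomial (lm m p) (1 : K) : MvPolynomial (Fin n) K)) =
      List.ofFn fun i ↦ monomial (m.degree (f i)) (1 : K) := by
    rw [List.map_ofFn]
    rfl
  rw [hmap, isGroebnerBasis_span_range_iff m h0]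
  constructor
  · intro hmon h hh hne
    have hspan : Ideal.span (Set.range fun i ↦ monomial (m.degree (f i)) (1 : K)) =
        Ideal.span ((fun s ↦ monomial s (1 : K)) '' Set.range fun i ↦ m.degree (f i)) := by
      rw [← Set.range_comp]
      rfl
    have hdis := pairwise_disjoint_of_isRegular hmon (u := fun i ↦ m.degree (f i))
      (fun i hi ↦ hmon.ofList_ne_top ((Ideal.eq_top_iff_one _).mpr (by
        rw [Ideal.ofList_ofFn]
        exact Ideal.subset_span ⟨i, by simp [hi]⟩)))
      (fun p hp hp0 ↦ by
        rw [hspan, mem_ideal_span_monomial_image] at hp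
        obtain ⟨d, hd⟩ := support_nonempty.mpr hp0
        obtain ⟨_, ⟨i, rfl⟩, hi⟩ := hp d hd
        exact ⟨d, hd, i, hi⟩)
    obtain ⟨i, -, hi⟩ := m.exists_degree_le_of_mem_span Finset.univ (fun i _ ↦ h0 i)
      (fun i _ j _ hij ↦ hdis hij) (by simpa using hh) hne
    exact ⟨i, hi⟩
  · intro H
    have hu (i) : m.degree (f i) ≠ 0 := fun hi ↦ by
      refine hreg.ofList_ne_top (Ideal.eq_top_of_isUnit_mem _ (x := f i) ?_ ?_)
      · rw [Ideal.ofList_ofFn]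
        exact Ideal.subset_span ⟨i, rfl⟩
      · rw [m.eq_C_of_degree_eq_zero hi]
        exact (m.leadingCoeff_ne_zero_iff.mpr (h0 i)).isUnit.map C
    refine isRegular_monomial hu (pairwise_disjoint_of_isRegular hreg hu fun h hh hne ↦ ?_)
    exact ⟨_, m.degree_mem_support hne, H h hh hne⟩
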